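/- arXiv:2404.03933 — 3 statements merged into one kernel-verified Lean document; each statement's English description precedes it below -/
import Mathlib

section
/- Let l ≥ 3 be an odd integer and q = e^{iπ/l} ∈ ℂ. For m, n ∈ ℤ, denote by [m choose l]_q and [n choose l]_q the limits of B_{m,l}(v) and B_{n,l}(v) as v → q over v ∈ ℂ \ Z_l (these limits exist). If q^{m} = q^{n} and [m choose l]_q = [n choose l]_q, then m = n. -/
open Filter

/-- The rational function `B_{m,r}(v) = ∏_{s=1}^{r} (v^{m-s+1} - v^{-(m-s+1)})/(v^s - v^{-s})`,
the specialization of the Gaussian binomial coefficient. -/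
noncomputable def gaussBinom (m : ℤ) (r : ℕ) (v : ℂ) : ℂ :=
  ∏ i ∈ Finset.range r,
    (v ^ (m - i) - v ^ (-(m - i))) / (v ^ ((i : ℤ) + 1) - v ^ (-((i : ℤ) + 1)))

/-- The set `Z_r = {0} ∪ {v : v^{2s} = 1 for some 1 ≤ s ≤ r}`. -/
def badSet (r : ℕ) : Set ℂ :=
  {0} ∪ {v : ℂ | ∃ s : ℕ, 1 ≤ s ∧ s ≤ r ∧ v ^ (2 * s) = 1}

/-- helper -/
noncomputable def ff (k : ℤ) (v : ℂ) : ℂ := v ^ k - v ^ (-k)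

lemma ff_deriv (k : ℤ) (q : ℂ) (h0 : q ≠ 0) :
    HasDerivAt (ff k) ((k : ℂ) * q⁻¹ * (q ^ k + q ^ (-k))) q := by
  have h1 := (hasDerivAt_zpow k q (Or.inl h0)).sub (hasDerivAt_zpow (-k) q (Or.inl h0))
  refine (h1.congr_deriv ?_)
  rw [zpow_sub_one₀ h0, zpow_sub_one₀ h0]
  push_cast
  ring

lemma ff_slope (k : ℤ) (q : ℂ) (h0 : q ≠ 0) (hz : ff k q = 0) :
    Tendsto (fun v => ff k v / (v - q)) (nhdsWithin q {q}ᶜ)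
      (nhds ((k : ℂ) * q⁻¹ * (q ^ k + q ^ (-k)))) := by
  have h := (hasDerivAt_iff_tendsto_slope.1 (ff_deriv k q h0))
  refine h.congr ?_
  intro v
  rw [slope_def_field, hz, sub_zero]

lemma ff_cont (k : ℤ) (q : ℂ) (h0 : q ≠ 0) :
    Tendsto (ff k) (nhdsWithin q {q}ᶜ) (nhds (ff k q)) :=
  ((ff_deriv k q h0).continuousAt.tendsto).mono_left nhdsWithin_le_nhds

lemma ff_zero_iff (l : ℕ) (q : ℂ) (hq : IsPrimitiveRoot q (2 * l)) (h0 : q ≠ 0) (k : ℤ) :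
    ff k q = 0 ↔ (l : ℤ) ∣ k := by
  unfold ff
  rw [sub_eq_zero, zpow_neg, ← mul_eq_one_iff_eq_inv₀ (zpow_ne_zero _ h0), ← zpow_add₀ h0,
    hq.zpow_eq_one_iff_dvd]
  push_cast
  rw [← two_mul]
  exact mul_dvd_mul_iff_left (by norm_num)

lemma ff_sum_ne (l : ℕ) (q : ℂ) (hq : IsPrimitiveRoot q (2 * l)) (h0 : q ≠ 0) (k : ℤ)
    (hk : (l : ℤ) ∣ k) : q ^ k + q ^ (-k) ≠ 0 := by
  have h := (ff_zero_iff l q hq h0 k).2 hk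
  unfold ff at h
  rw [sub_eq_zero] at h
  rw [← h, ← two_mul]
  exact mul_ne_zero two_ne_zero (zpow_ne_zero _ h0)

/-- the common factor -/
noncomputable def GG (l i0 : ℕ) (q x : ℂ) : ℂ :=
  (q⁻¹ * (x / q ^ (i0 : ℤ) + (x / q ^ (i0 : ℤ))⁻¹)) / ((l : ℂ) * q⁻¹ * (q ^ (l : ℤ) + q ^ (-(l : ℤ)))) *
    ((∏ i ∈ (Finset.range l).erase i0, (x / q ^ (i : ℤ) - (x / q ^ (i : ℤ))⁻¹)) /
      ∏ i ∈ Finset.range (l - 1), ff ((i : ℤ) + 1) q)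

lemma GG_ne (l i0 : ℕ) (hl : 0 < l) (hi : i0 < l) (q : ℂ) (hq : IsPrimitiveRoot q (2 * l))
    (h0 : q ≠ 0) (m : ℤ) (hm : (l : ℤ) ∣ m - i0) : GG l i0 q (q ^ m) ≠ 0 := by
  unfold GG
  simp only [← zpow_sub₀ h0, ← zpow_neg]
  refine mul_ne_zero (div_ne_zero (mul_ne_zero (inv_ne_zero h0) ?_)
    (mul_ne_zero (mul_ne_zero ?_ (inv_ne_zero h0)) ?_)) (div_ne_zero ?_ ?_)
  · exact ff_sum_ne l q hq h0 _ hm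
  · exact_mod_cast hl.ne'
  · exact ff_sum_ne l q hq h0 _ dvd_rfl
  · refine Finset.prod_ne_zero_iff.2 fun i hi' => ?_
    rw [Finset.mem_erase, Finset.mem_range] at hi'
    change ff (m - i) q ≠ 0
    rw [Ne, ff_zero_iff l q hq h0]
    intro h
    have h2 := dvd_sub h hm
    have h3 : (m - i - (m - i0) : ℤ) = (i0 : ℤ) - i := by ring
    rw [h3] at h2
    have := Int.eq_zero_of_abs_lt_dvd h2 (by rw [abs_lt]; omega)
    omega
  · refine Finset.prod_ne_zero_iff.2 fun i hi' => ?_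
    rw [Finset.mem_range] at hi'
    rw [Ne, ff_zero_iff l q hq h0]
    intro h
    have := Int.le_of_dvd (by omega) h
    omega

lemma gb_lim (l i0 : ℕ) (hl : 0 < l) (hi : i0 < l) (q : ℂ) (hq : IsPrimitiveRoot q (2 * l))
    (h0 : q ≠ 0) (m : ℤ) (hm : (l : ℤ) ∣ m - i0) :
    Tendsto (gaussBinom m l) (nhdsWithin q {q}ᶜ)
      (nhds (((m - i0 : ℤ) : ℂ) * GG l i0 q (q ^ m))) := by
  have hA := (ff_slope (m - i0) q h0 ((ff_zero_iff l q hq h0 _).2 hm)).div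
    (ff_slope l q h0 ((ff_zero_iff l q hq h0 _).2 dvd_rfl))
    (mul_ne_zero (mul_ne_zero (by exact_mod_cast hl.ne') (inv_ne_zero h0))
      (ff_sum_ne l q hq h0 _ dvd_rfl))
  have hN : Tendsto (fun v => ∏ i ∈ (Finset.range l).erase i0, ff (m - i) v)
      (nhdsWithin q {q}ᶜ) (nhds (∏ i ∈ (Finset.range l).erase i0, ff (m - i) q)) :=
    tendsto_finsetProd _ fun i _ => ff_cont _ q h0
  have hD : Tendsto (fun v => ∏ i ∈ Finset.range (l - 1), ff ((i : ℤ) + 1) v)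
      (nhdsWithin q {q}ᶜ) (nhds (∏ i ∈ Finset.range (l - 1), ff ((i : ℤ) + 1) q)) :=
    tendsto_finsetProd _ fun i _ => ff_cont _ q h0
  have hDne : (∏ i ∈ Finset.range (l - 1), ff ((i : ℤ) + 1) q) ≠ 0 := by
    refine Finset.prod_ne_zero_iff.2 fun i hi' => ?_
    rw [Finset.mem_range] at hi'
    rw [Ne, ff_zero_iff l q hq h0]
    intro h
    have := Int.le_of_dvd (by omega) h
    omega
  have hT := hA.mul (hN.div hD hDne)
  have e : ((m - i0 : ℤ) : ℂ) * GG l i0 q (q ^ m) =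
      ((m - i0 : ℤ) : ℂ) * q⁻¹ * (q ^ (m - i0) + q ^ (-(m - i0))) /
        (((l : ℤ) : ℂ) * q⁻¹ * (q ^ (l : ℤ) + q ^ (-(l : ℤ)))) *
        ((∏ i ∈ (Finset.range l).erase i0, ff (m - i) q) /
          ∏ i ∈ Finset.range (l - 1), ff ((i : ℤ) + 1) q) := by
    unfold GG
    simp only [← zpow_sub₀ h0, ← zpow_neg]
    rw [← mul_assoc, mul_assoc (((m - i0 : ℤ) : ℂ)) q⁻¹, mul_div_assoc (((m - i0 : ℤ) : ℂ)),
      Int.cast_natCast]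
    rfl
  rw [e]
  refine hT.congr' ?_
  filter_upwards [self_mem_nhdsWithin] with v hv
  have hv' : v - q ≠ 0 := sub_ne_zero.2 hv
  have hg : gaussBinom m l v = (∏ i ∈ Finset.range l, ff (m - i) v) /
      ∏ i ∈ Finset.range l, ff ((i : ℤ) + 1) v := by
    rw [← Finset.prod_div_distrib]; rfl
  rw [hg, ← Finset.mul_prod_erase _ _ (Finset.mem_range.2 hi)]
  obtain ⟨k, rfl⟩ : ∃ k, l = k + 1 := ⟨l - 1, by omega⟩
  rw [Finset.prod_range_succ]
  simp only [Pi.div_apply, Nat.add_sub_cancel]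
  rw [div_div_div_cancel_right₀ hv', div_mul_div_comm]
  push_cast
  rw [mul_comm (ff ((k : ℤ) + 1) v)]

lemma bad_fin (l : ℕ) : (badSet l).Finite := by
  unfold badSet
  refine (Set.finite_singleton _).union ?_
  refine ((Set.finite_Icc 1 l).biUnion (t := fun s => {v : ℂ | v ^ (2 * s) = 1}) ?_).subset ?_
  · intro s hs
    have hs1 : 0 < 2 * s := by have := hs.1; omega
    refine (Polynomial.nthRootsFinset (2 * s) (1 : ℂ)).finite_toSet.subset ?_
    intro v hv
    simpa [Polynomial.mem_nthRootsFinset hs1] using hv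
  · rintro v ⟨s, h1, h2, h3⟩
    simp only [Set.mem_iUnion]
    exact ⟨s, ⟨h1, h2⟩, h3⟩

lemma bad_le (l : ℕ) (q : ℂ) : nhdsWithin q {q}ᶜ ≤ nhdsWithin q (badSet l)ᶜ := by
  refine le_inf nhdsWithin_le_nhds ?_
  rw [le_principal_iff]
  have h : ((badSet l) \ {q})ᶜ ∈ nhds q :=
    ((bad_fin l).subset Set.sdiff_subset).isClosed.isOpen_compl.mem_nhds (by simp)
  filter_upwards [self_mem_nhdsWithin, nhdsWithin_le_nhds h] with v hv hv2 hv3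
  exact hv2 ⟨hv3, hv⟩

theorem stmt4 (l : ℕ) (hl : Odd l) (hl3 : 3 ≤ l) (m n : ℤ) (a b : ℂ)
    (ha : Tendsto (gaussBinom m l)
      (nhdsWithin (Complex.exp (Real.pi * Complex.I / l)) (badSet l)ᶜ) (nhds a))
    (hb : Tendsto (gaussBinom n l)
      (nhdsWithin (Complex.exp (Real.pi * Complex.I / l)) (badSet l)ᶜ) (nhds b))
    (hq : Complex.exp (Real.pi * Complex.I / l) ^ m = Complex.exp (Real.pi * Complex.I / l) ^ n)
    (hab : a = b) : m = n := by
  have hl0 : 0 < l := by omega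
  have hq0 : Complex.exp (Real.pi * Complex.I / l) ≠ 0 := Complex.exp_ne_zero _
  have hprim : IsPrimitiveRoot (Complex.exp (Real.pi * Complex.I / l)) (2 * l) := by
    have h := Complex.isPrimitiveRoot_exp (2 * l) (by omega)
    have e : (2 * Real.pi * Complex.I / ((2 * l : ℕ) : ℂ)) = Real.pi * Complex.I / l := by
      push_cast
      rw [mul_assoc, mul_div_mul_left _ _ two_ne_zero]
    rwa [e] at h
  generalize Complex.exp (Real.pi * Complex.I / l) = q at *
  have hlz : (0 : ℤ) < l := by exact_mod_cast hl0
  obtain ⟨i0, hi0⟩ := Int.eq_ofNat_of_zero_le (Int.emod_nonneg m hlz.ne')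
  have hi : i0 < l := by
    have := Int.emod_lt_of_pos m hlz
    omega
  have hm : (l : ℤ) ∣ m - i0 := by
    rw [← hi0]; exact Int.dvd_self_sub_emod
  have hmn : (l : ℤ) ∣ n - m := by
    have h : q ^ (n - m) = 1 := by
      rw [zpow_sub₀ hq0, hq, div_self (zpow_ne_zero _ hq0)]
    rw [hprim.zpow_eq_one_iff_dvd] at h
    exact (Dvd.intro_left 2 (by push_cast; rfl)).trans h
  have hn : (l : ℤ) ∣ n - i0 := by
    have := dvd_add hmn hm
    rwa [sub_add_sub_cancel] at this
  have h1 := tendsto_nhds_unique (ha.mono_left (bad_le l q)) (gb_lim l i0 hl0 hi q hprim hq0 m hm)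
  have h2 := tendsto_nhds_unique (hb.mono_left (bad_le l q)) (gb_lim l i0 hl0 hi q hprim hq0 n hn)
  rw [← hq] at h2
  have h3 := mul_right_cancel₀ (GG_ne l i0 hl0 hi q hprim hq0 m hm) (h1.symm.trans (hab.trans h2))
  have h4 : m - i0 = n - i0 := by exact_mod_cast h3
  omega
end

section
/- Let l ≥ 3 be an odd integer. For all N ∈ ℕ and k ∈ ℕ, the total weight of all lattice paths of length N from 0 to k in the step model S_U equals the multiplicity M^{(l)}_k(N), i.e. Σ_{p : path of length N, p(0)=0, p(N)=k} ∏_{i=0}^{N−1} w(p(i), p(i+1)) = M^{(l)}_k(N). -/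
/-- `intBinom N j = binom(N, j)` for an integer `j`, with the convention that it vanishes
for `j < 0` or `j > N`. -/
def intBinom (N : ℕ) (j : ℤ) : ℤ :=
  if 0 ≤ j ∧ j ≤ (N : ℤ) then (N.choose j.toNat : ℤ) else 0

/-- `Fcoef N k = F^{(N)}_k = binom(N,(N−k)/2) − binom(N,(N−k−2)/2)` if `k ≡ N (mod 2)`,
and `0` otherwise. -/
def Fcoef (N : ℕ) (k : ℤ) : ℤ :=
  if ((N : ℤ) - k) % 2 = 0 then
    intBinom N (((N : ℤ) - k) / 2) - intBinom N (((N : ℤ) - k - 2) / 2)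
  else 0

/-- The multiplicity `M^{(l)}_k(N)` of the tilting module `T(k)` in `T(1)^{⊗N}`.
Writing `k = k₁ l + k₀` with `0 ≤ k₀ ≤ l−1`, it is `F^{(N)}_k` when `k₀ = l−1`, and
`Σ_{j≥0} (F^{(N)}_{k+2jl} − F^{(N)}_{(k₁+2j+2)l−k₀−2})` when `0 ≤ k₀ ≤ l−2`; all terms of the
infinite sum with `j > N` vanish, so it is truncated at `j = N`. -/
def Mmult (l k N : ℕ) : ℤ :=
  if k % l = l - 1 then Fcoef N k
  else ∑ j ∈ Finset.range (N + 1),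
    (Fcoef N ((k : ℤ) + 2 * j * l) -
      Fcoef N ((((k / l : ℕ) : ℤ) + 2 * (j : ℤ) + 2) * l - ((k % l : ℕ) : ℤ) - 2))

/-- The weight function of the step model `S_U` on nonnegative integers:
`w(0,1) = 1`; for `x = ml−1` (`m ≥ 1`), `w(x, x+1) = 1`; for `x = ml` (`m ≥ 1`),
`w(x, x+1) = 1` and `w(x, x−1) = 2`; for `x = ml−2` (`m ≥ 3`),
`w(x, x+1) = w(x, x−1) = w(x, (m−2)l−1) = 1`; for every other `x ≥ 1`,
`w(x, x+1) = w(x, x−1) = 1`; all other pairs get weight `0`. -/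
def stepWeight (l : ℕ) (x y : ℕ) : ℤ :=
  if x = 0 then (if y = 1 then 1 else 0)
  else if x % l = l - 1 then (if y = x + 1 then 1 else 0)
  else if x % l = 0 then (if y = x + 1 then 1 else if y + 1 = x then 2 else 0)
  else if x % l = l - 2 ∧ 3 * l - 2 ≤ x then
    (if y = x + 1 then 1 else if y + 1 = x then 1 else if y + 2 * l = x + 1 then 1 else 0)
  else (if y = x + 1 then 1 else if y + 1 = x then 1 else 0)

lemma aux_intBinom (N : ℕ) (j : ℤ) : intBinom (N+1) j = intBinom N j + intBinom N (j-1) := by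
  unfold intBinom
  rcases lt_trichotomy j 0 with h | h | h
  · split_ifs <;> first | rfl | omega
  · subst h
    rw [if_pos (by omega), if_pos (by omega), if_neg (by omega)]; simp
  · obtain ⟨m, rfl⟩ : ∃ m : ℕ, j = m + 1 := ⟨(j-1).toNat, by omega⟩
    have e1 : ((m:ℤ) + 1).toNat = m + 1 := by omega
    have e2 : ((m:ℤ) + 1 - 1).toNat = m := by omega
    rw [e1, e2, Nat.choose_succ_succ]
    by_cases h1 : m + 1 ≤ N
    · rw [if_pos (by push_cast; omega), if_pos (by omega), if_pos (by omega)]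
      push_cast; ring
    · by_cases h2 : m = N
      · subst h2
        rw [if_pos (by push_cast; omega), if_neg (by omega), if_pos (by omega)]
        simp
      · rw [if_neg (by push_cast; omega), if_neg (by omega), if_neg (by omega)]; rfl

lemma aux_F_succ (N : ℕ) (k : ℤ) : Fcoef (N+1) k = Fcoef N (k-1) + Fcoef N (k+1) := by
  unfold Fcoef
  by_cases h : ((N:ℤ) + 1 - k) % 2 = 0
  · rw [if_pos (by push_cast; exact h), if_pos (by omega), if_pos (by omega),
      aux_intBinom, aux_intBinom]
    have e1 : (((N+1:ℕ):ℤ) - k)/2 = ((N:ℤ) - (k-1))/2 := by push_cast; congr 1; ring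
    have e2 : (((N+1:ℕ):ℤ) - k)/2 - 1 = ((N:ℤ) - (k+1))/2 := by push_cast; omega
    have e3 : (((N+1:ℕ):ℤ) - k - 2)/2 = ((N:ℤ) - (k-1) - 2)/2 := by push_cast; omega
    have e4 : (((N+1:ℕ):ℤ) - k - 2)/2 - 1 = ((N:ℤ) - (k+1) - 2)/2 := by push_cast; omega
    rw [e2, e4, e1, e3]; ring
  · rw [if_neg (by push_cast; exact h), if_neg (by omega), if_neg (by omega)]; rfl

lemma aux_F_big (N : ℕ) (k : ℤ) (h : (N:ℤ) < k) : Fcoef N k = 0 := by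
  unfold Fcoef intBinom
  split_ifs <;> first | rfl | omega

lemma aux_ib_symm (N : ℕ) (j : ℤ) : intBinom N (N - j) = intBinom N j := by
  unfold intBinom
  by_cases h : 0 ≤ j ∧ j ≤ N
  · rw [if_pos (by omega), if_pos h]
    have : ((N:ℤ) - j).toNat = N - j.toNat := by omega
    rw [this, Nat.choose_symm (by omega)]
  · rw [if_neg (by omega), if_neg h]

lemma aux_F_neg (N : ℕ) : Fcoef N (-1) = 0 := by
  unfold Fcoef
  split_ifs with h
  · rw [← aux_ib_symm]
    have : (N:ℤ) - (N - -1)/2 = (N - -1 - 2)/2 := by omega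
    rw [this]; ring
  · rfl

def auxA (l J N : ℕ) (a : ℤ) : ℤ := ∑ j ∈ Finset.range J, Fcoef N (a + 2 * j * l)

lemma auxA_succ (l J N : ℕ) (a : ℤ) :
    auxA l J (N+1) a = auxA l J N (a-1) + auxA l J N (a+1) := by
  unfold auxA
  rw [← Finset.sum_add_distrib]
  refine Finset.sum_congr rfl fun j _ => ?_
  rw [aux_F_succ]
  congr 2 <;> ring

lemma auxA_tel (l J N : ℕ) (hl : 1 ≤ l) (hJ : N + 1 ≤ J) (a : ℤ) (ha : -1 ≤ a) :
    auxA l J N a = Fcoef N a + auxA l J N (a + 2 * l) := by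
  have h1 : auxA l (J+1) N a = auxA l J N a := by
    unfold auxA
    rw [Finset.sum_range_succ, aux_F_big, add_zero]
    have : (J:ℤ) ≤ J * l := by nlinarith
    nlinarith
  rw [← h1]
  unfold auxA
  rw [Finset.sum_range_succ', add_comm]
  congr 1
  · simp
  · refine Finset.sum_congr rfl fun j _ => ?_
    congr 1; push_cast; ring

lemma aux_M (l q r J N : ℕ) (hr : r + 2 ≤ l) (hJ : N + 1 ≤ J) (k : ℕ) (hk : k = q * l + r) :
    Mmult l k N = auxA l J N k - auxA l J N (k + 2 * l - 2 * r - 2) := by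
  have hm : k % l = r := by
    rw [hk, mul_comm, Nat.mul_add_mod, Nat.mod_eq_of_lt (by omega)]
  have hd : k / l = q := by
    have := Nat.div_add_mod k l
    rw [hm, hk] at this
    have h2 : l * ((q * l + r) / l) = l * q := by linarith [mul_comm l q]
    rw [hk]; exact Nat.eq_of_mul_eq_mul_left (by omega) h2
  unfold Mmult auxA
  rw [if_neg (by omega), hm, hd, ← Finset.sum_sub_distrib]
  have hsub : Finset.range (N+1) ⊆ Finset.range J := by
    intro x; simp; omega
  rw [← Finset.sum_subset hsub]
  · refine Finset.sum_congr rfl fun j _ => ?_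
    congr 2
    rw [hk]; push_cast; ring
  · intro j _ hj
    have hj : N + 1 ≤ j := by simpa using hj
    have : (j:ℤ) ≤ j * l := by nlinarith
    rw [aux_F_big, aux_F_big, sub_zero]
    · nlinarith
    · nlinarith

lemma aux_M_top (l q N : ℕ) (hl : 1 ≤ l) (k : ℕ) (hk : k + 1 = q * l + l) :
    Mmult l k N = Fcoef N k := by
  have : k = q * l + (l - 1) := by omega
  unfold Mmult
  rw [if_pos]
  rw [this, mul_comm, Nat.mul_add_mod, Nat.mod_eq_of_lt (by omega)]

lemma aux_M_big (l k N : ℕ) (hl : 3 ≤ l) (h : N < k) : Mmult l k N = 0 := by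
  unfold Mmult
  have hm := Nat.div_add_mod k l
  have hlt := Nat.mod_lt k (show 0 < l by omega)
  split_ifs with h1
  · exact aux_F_big _ _ (by omega)
  · refine Finset.sum_eq_zero fun j _ => ?_
    zify at hm hlt h
    have : 0 ≤ (j:ℤ) * l := by positivity
    rw [aux_F_big, aux_F_big, sub_zero]
    · push_cast; nlinarith
    · nlinarith

def auxC (l y : ℕ) : ℤ := if y % l = l - 2 then 0 else if y % l = l - 1 then 2 else 1
def auxD (l y : ℕ) : ℤ := if y % l = l - 1 then 1 else 0

lemma aux_M_rec (l k N : ℕ) (hl : 3 ≤ l) :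
    Mmult l k (N+1) = (if 1 ≤ k then Mmult l (k-1) N else 0) + auxC l k * Mmult l (k+1) N
      + auxD l k * Mmult l (k + 2 * l - 1) N := by
  obtain ⟨q, r, hr, hk⟩ : ∃ q r, r < l ∧ k = q * l + r :=
    ⟨k / l, k % l, Nat.mod_lt _ (by omega), by rw [mul_comm]; exact (Nat.div_add_mod k l).symm⟩
  have hm : k % l = r := by rw [hk, mul_comm, Nat.mul_add_mod, Nat.mod_eq_of_lt hr]
  unfold auxC auxD
  rw [hm]
  have hlz : (3:ℤ) ≤ l := by exact_mod_cast hl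
  by_cases h1 : r = l - 1
  · rw [if_pos (by omega), if_neg (by omega), if_pos h1, if_pos h1,
      aux_M_top l q (N+1) (by omega) k (by omega), aux_F_succ,
      aux_M l q (l-2) (N+2) N (by omega) (by omega) (k-1) (by omega),
      aux_M l (q+1) 0 (N+2) N (by omega) (by omega) (k+1) (by rw [add_mul]; omega),
      aux_M l (q+2) (l-2) (N+2) N (by omega) (by omega) (k+2*l-1) (by rw [add_mul]; omega)]
    have e1 : ((k-1:ℕ):ℤ) = k - 1 := by omega
    have e2 : ((k+2*l-1:ℕ):ℤ) = k - 1 + 2 * l := by omega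
    have e3 : ((l-2:ℕ):ℤ) = l - 2 := by omega
    have t1 := auxA_tel l (N+2) N (by omega) (by omega) ((k:ℤ)-1) (by omega)
    have t2 := auxA_tel l (N+2) N (by omega) (by omega) ((k:ℤ)+1) (by omega)
    rw [e1, e2, e3]
    push_cast
    have f1 : (k:ℤ) - 1 + 2 * l - 2 * (l-2) - 2 = k + 1 := by ring
    have f2 : (k:ℤ) - 1 + 2 * l + 2 * l - 2 * (l-2) - 2 = k + 1 + 2 * l := by ring
    have f3 : (k:ℤ) + 1 + 2 * l - 0 - 2 = k - 1 + 2 * l := by ring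
    rw [f1, f2, f3]
    linarith
  rw [if_neg h1, if_neg h1, zero_mul, add_zero,
    aux_M l q r (N+2) (N+1) (by omega) (by omega) k hk, auxA_succ, auxA_succ]
  by_cases h2 : r = l - 2
  · rw [if_pos (by omega), if_pos h2,
      aux_M l q (r-1) (N+2) N (by omega) (by omega) (k-1) (by omega)]
    have e1 : ((k-1:ℕ):ℤ) = k - 1 := by omega
    have e3 : ((r-1:ℕ):ℤ) = l - 3 := by omega
    have e4 : (r:ℤ) = l - 2 := by omega
    rw [e1, e3, e4]
    have f1 : (k:ℤ) + 2 * l - 2 * (l-2) - 2 - 1 = k + 1 := by ring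
    have f2 : (k:ℤ) + 2 * l - 2 * (l-2) - 2 + 1 = k + 3 := by ring
    have f3 : (k:ℤ) - 1 + 2 * l - 2 * (l-3) - 2 = k + 3 := by ring
    rw [f1, f2, f3]; ring
  rw [if_neg h2, one_mul,
    aux_M l q (r+1) (N+2) N (by omega) (by omega) (k+1) (by omega)]
  by_cases h3 : r = 0
  · have t1 := auxA_tel l (N+2) N (by omega) (by omega) ((k:ℤ)-1) (by omega)
    have hz : (if 1 ≤ k then Mmult l (k-1) N else 0) = Fcoef N (k-1) := by
      split_ifs with hk1
      · have hq : q ≠ 0 := by rintro rfl; omega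
        obtain ⟨p, rfl⟩ := Nat.exists_eq_succ_of_ne_zero hq
        rw [aux_M_top l p N (by omega) (k-1) (by rw [Nat.succ_mul] at hk; omega)]
        congr 1; omega
      · have : k = 0 := by omega
        rw [this]; exact (aux_F_neg N).symm
    rw [hz, h3]
    push_cast
    have f1 : (k:ℤ) + 2 * l - 0 - 2 - 1 = k + 1 + 2 * l - 2 - 2 := by ring
    have f2 : (k:ℤ) + 2 * l - 0 - 2 + 1 = k - 1 + 2 * l := by ring
    rw [f1, f2]; linarith
  · rw [if_pos (by omega),
      aux_M l q (r-1) (N+2) N (by omega) (by omega) (k-1) (by omega)]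
    have e1 : ((k-1:ℕ):ℤ) = k - 1 := by omega
    have e3 : ((r-1:ℕ):ℤ) = r - 1 := by omega
    rw [e1, e3]
    push_cast
    have f1 : (k:ℤ) + 2 * l - 2 * r - 2 - 1 = k + 1 + 2 * l - 2 * (r+1) - 2 := by ring
    have f2 : (k:ℤ) + 2 * l - 2 * r - 2 + 1 = k - 1 + 2 * l - 2 * (r-1) - 2 := by ring
    rw [f1, f2]; ring

lemma aux_mod (l x : ℕ) (hl : 3 ≤ l) :
    (x % l = l - 1 ∧ (x+1) % l = 0) ∨ (x % l < l - 1 ∧ (x+1) % l = x % l + 1) := by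
  have hlt := Nat.mod_lt x (show 0 < l by omega)
  rw [Nat.add_mod, Nat.mod_eq_of_lt (show 1 < l by omega)]
  by_cases h : x % l = l - 1
  · left; refine ⟨h, ?_⟩
    rw [h, show l - 1 + 1 = l by omega, Nat.mod_self]
  · right; exact ⟨by omega, Nat.mod_eq_of_lt (by omega)⟩

lemma aux_w (l x y : ℕ) (hl : 3 ≤ l) : stepWeight l x y =
    (if x + 1 = y then 1 else 0) + (if x = y + 1 then auxC l y else 0)
      + (if x = y + 2 * l - 1 then auxD l y else 0) := by
  unfold stepWeight auxC auxD
  have hx0 : x = 0 → x % l = 0 := by rintro rfl; simp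
  have hle := Nat.mod_le y l
  by_cases a : x + 1 = y
  · rw [if_pos a, if_neg (show ¬ x = y + 1 by omega), if_neg (show ¬ x = y + 2 * l - 1 by omega)]
    split_ifs <;> first | rfl | omega
  by_cases b : x = y + 1
  · have hm := aux_mod l y hl
    rw [← b] at hm
    rw [if_neg a, if_pos b, if_neg (show ¬ x = y + 2 * l - 1 by omega)]
    generalize x % l = u at *
    generalize y % l = v at *
    split_ifs <;> first | rfl | omega
  by_cases c : x = y + 2 * l - 1
  · have hm := aux_mod l x hl
    have : (x + 1) % l = y % l := by
      rw [show x + 1 = y + l * 2 by omega, Nat.add_mul_mod_self_left]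
    rw [this] at hm
    rw [if_neg a, if_neg b, if_pos c]
    generalize x % l = u at *
    generalize y % l = v at *
    split_ifs <;> first | rfl | omega
  · rw [if_neg a, if_neg b, if_neg c]
    split_ifs <;> first | rfl | omega

lemma aux_sum (l B N k : ℕ) (hl : 3 ≤ l) (hB : N + 1 ≤ B) (hk : k ≤ B) :
    ∑ x ∈ Finset.range (B+1), Mmult l x N * stepWeight l x k = Mmult l k (N+1) := by
  rw [aux_M_rec l k N hl]
  simp only [aux_w l _ k hl, mul_add, Finset.sum_add_distrib, mul_ite, mul_zero, mul_one]
  congr 1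
  · congr 1
    · split_ifs with h
      · rw [Finset.sum_eq_single (k-1)]
        · rw [if_pos (by omega)]
        · intro b _ hb; rw [if_neg (by omega)]
        · intro hb; simp at hb; omega
      · refine Finset.sum_eq_zero fun x _ => by rw [if_neg (by omega)]
    · rw [Finset.sum_ite_eq']
      split_ifs with h
      · ring
      · simp at h; rw [aux_M_big l (k+1) N hl (by omega)]; ring
  · rw [Finset.sum_ite_eq']
    split_ifs with h
    · ring
    · simp only [Finset.mem_range] at h
      rw [aux_M_big l (k+2*l-1) N hl (by omega)]; ring

lemma aux_paths (l B : ℕ) (hl : 3 ≤ l) (N : ℕ) (hN : N ≤ B) : ∀ k : Fin (B+1),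
    ∑ p : Fin (N + 1) → Fin (B + 1), (if (p 0 : ℕ) = 0 ∧ p (Fin.last N) = k then
      ∏ i : Fin N, stepWeight l (p i.castSucc) (p i.succ) else 0) = Mmult l k N := by
  induction N with
  | zero =>
    intro k
    rw [← (Equiv.funUnique (Fin 1) (Fin (B+1))).symm.sum_comp]
    simp only [Equiv.funUnique_symm_apply, Finset.univ_eq_empty, Finset.prod_empty]
    by_cases h : (k:ℕ) = 0
    · rw [Finset.sum_eq_single k]
      · rw [h]
        simp [h]
        rw [aux_M l 0 0 1 0 (by omega) (by omega) 0 (by simp)]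
        unfold auxA
        simp
        rw [aux_F_big 0 (2 * l - 2) (by push_cast; omega)]
        simp [Fcoef, intBinom]
      · intro b _ hb
        simp [hb]
      · simp
    · rw [aux_M_big l k 0 hl (by omega)]
      refine Finset.sum_eq_zero fun b _ => ?_
      rw [if_neg]
      rintro ⟨h1, h2⟩
      apply h
      rw [← h2]; exact h1
  | succ N ih =>
    intro k
    have ih := ih (by omega)
    rw [← aux_sum l B N k hl hN (by omega), Finset.sum_range]
    simp_rw [← ih]
    rw [← (Fin.snocEquiv (fun _ : Fin (N+2) => Fin (B+1))).sum_comp, Fintype.sum_prod_type,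
      Finset.sum_comm]
    simp_rw [Finset.sum_mul]
    rw [Finset.sum_comm (s := (Finset.univ : Finset (Fin (B+1))))]
    refine Finset.sum_congr rfl fun p _ => ?_
    rw [Finset.sum_eq_single k, Finset.sum_eq_single (p (Fin.last N))]
    · simp only [Fin.snocEquiv_apply, Fin.snoc_last, Fin.prod_univ_castSucc]
      have e0 : (Fin.snoc p k : Fin (N+2) → Fin (B+1)) 0 = p 0 := by
        have := Fin.snoc_castSucc (α := fun _ => Fin (B+1)) k p 0
        simpa using this
      rw [e0]
      simp only [← Fin.castSucc_succ, Fin.succ_last, Fin.snoc_castSucc, Fin.snoc_last]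
      by_cases h : (p 0 : ℕ) = 0 <;> simp [h]
    · intro b _ hb
      rw [if_neg (fun h => hb h.2.symm), zero_mul]
    · simp
    · intro b _ hb
      rw [if_neg]
      rintro ⟨_, h⟩
      exact hb (by simpa using h)
    · simp

/-- Any lattice path of length `N` starting at `0` with nonzero weight stays within
`{0, …, N}`, so paths are encoded as functions `Fin (N+1) → Fin (N+1)`. -/
theorem stmt11 (l : ℕ) (hl : Odd l) (hl3 : 3 ≤ l) (N k : ℕ) :
    ∑ p ∈ Finset.univ.filter
        (fun p : Fin (N + 1) → Fin (N + 1) => (p 0 : ℕ) = 0 ∧ (p (Fin.last N) : ℕ) = k),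
      ∏ i : Fin N, stepWeight l (p i.castSucc) (p i.succ)
    = Mmult l k N := by
  rw [Finset.sum_filter]
  by_cases h : k < N + 1
  · have := aux_paths l N hl3 N le_rfl ⟨k, h⟩
    simp only [Fin.ext_iff] at this
    exact this
  · rw [aux_M_big l k N hl3 (by omega)]
    refine Finset.sum_eq_zero fun p _ => ?_
    rw [if_neg]
    rintro ⟨_, h2⟩
    have := (p (Fin.last N)).isLt
    omega
end

section
/- Fix an odd integer l ≥ 3 and s ∈ ℕ. Then lim_{N→∞} s! · M^{(l)}_{N−2s}(N) / N^{s} = 1, where the limit is over integers N ≥ 2s tending to infinity. -/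
open Filter

lemma intBinom_nonneg' (N : ℕ) (j : ℤ) : 0 ≤ intBinom N j := by
  unfold intBinom; split_ifs <;> positivity

lemma intBinom_neg' (N : ℕ) (j : ℤ) (h : j < 0) : intBinom N j = 0 := by
  unfold intBinom; rw [if_neg]; omega

lemma intBinom_bound (N s : ℕ) (hN : 1 ≤ N) (j : ℤ) (h : j < s) :
    intBinom N j * N ≤ (N : ℤ) ^ s := by
  unfold intBinom
  split_ifs with h1
  · have h2 : j.toNat + 1 ≤ s := by omega
    have h3 : N.choose j.toNat * N ≤ N ^ s :=
      calc N.choose j.toNat * N ≤ N ^ j.toNat * N :=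
            Nat.mul_le_mul_right _ (Nat.choose_le_pow _ _)
        _ = N ^ (j.toNat + 1) := (pow_succ _ _).symm
        _ ≤ N ^ s := Nat.pow_le_pow_right hN h2
    exact_mod_cast h3
  · rw [zero_mul]; positivity

lemma Fcoef_zero (N : ℕ) (k : ℤ) (h : (N : ℤ) < k) : Fcoef N k = 0 := by
  unfold Fcoef
  split_ifs
  · rw [intBinom_neg' _ _ (by omega), intBinom_neg' _ _ (by omega)]; rfl
  · rfl

lemma Fcoef_bound (N s : ℕ) (hN : 1 ≤ N) (k : ℤ) (h : (N : ℤ) - 2 * s < k) :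
    |Fcoef N k * N| ≤ (N : ℤ) ^ s := by
  unfold Fcoef
  split_ifs
  · have a1 := intBinom_bound N s hN (((N : ℤ) - k) / 2) (by omega)
    have a2 := intBinom_bound N s hN (((N : ℤ) - k - 2) / 2) (by omega)
    have b1 := mul_nonneg (intBinom_nonneg' N (((N : ℤ) - k) / 2)) (Int.natCast_nonneg N)
    have b2 := mul_nonneg (intBinom_nonneg' N (((N : ℤ) - k - 2) / 2)) (Int.natCast_nonneg N)
    rw [sub_mul, abs_le]; constructor <;> linarith
  · simp

lemma Fcoef_main (N s : ℕ) (hN : 1 ≤ N) (hs : 2 * s ≤ N) :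
    |(Fcoef N ((N - 2 * s : ℕ) : ℤ) - N.choose s) * N| ≤ (N : ℤ) ^ s := by
  have e : ((N - 2 * s : ℕ) : ℤ) = N - 2 * s := by omega
  have e1 : ((N : ℤ) - (N - 2 * s)) / 2 = s := by omega
  have e2 : ((N : ℤ) - (N - 2 * s) - 2) / 2 = s - 1 := by omega
  have e3 : intBinom N s = N.choose s := by
    unfold intBinom; rw [if_pos (by omega)]; simp
  unfold Fcoef
  rw [e, if_pos (by omega), e1, e2, e3]
  have a := intBinom_bound N s hN (s - 1) (by omega)
  have b := mul_nonneg (intBinom_nonneg' N (s - 1)) (Int.natCast_nonneg N)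
  rw [abs_le]; constructor <;> linarith

lemma Mmult_bound (l s N : ℕ) (hl3 : 3 ≤ l) (hN : 1 ≤ N) (hs : 2 * s ≤ N) :
    |(Mmult l (N - 2 * s) N - N.choose s) * N| ≤ (s + 1) * 2 * (N : ℤ) ^ s := by
  have hm := Fcoef_main N s hN hs
  have hp : (0 : ℤ) ≤ (N : ℤ) ^ s := by positivity
  have hsp : (0 : ℤ) ≤ s * (N : ℤ) ^ s := by positivity
  unfold Mmult
  split_ifs with h
  · linarith
  have e : ((N - 2 * s : ℕ) : ℤ) = N - 2 * s := by omega
  have hk := Nat.div_add_mod (N - 2 * s) l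
  have hlt := Nat.mod_lt (N - 2 * s) (show 0 < l by omega)
  generalize hK : N - 2 * s = K at *
  generalize K / l = k1 at *
  generalize K % l = k0 at *
  have hkz : (l : ℤ) * k1 + k0 = K := by exact_mod_cast hk
  have hidx : ∀ j : ℕ, ((k1 : ℤ) + 2 * (j : ℤ) + 2) * l - (k0 : ℤ) - 2
      = K + 2 * (j * l) + 2 * (l - k0 - 1) := by
    intro j; rw [← hkz]; ring
  have hc : (l : ℤ) - k0 - 1 ≥ 1 := by omega
  have hjl : ∀ j : ℕ, (j : ℤ) ≤ j * l := by
    intro j; nlinarith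
  have hz : ∀ j : ℕ, s < j → (Fcoef N ((K : ℤ) + 2 * j * l) -
      Fcoef N (((k1 : ℤ) + 2 * (j : ℤ) + 2) * l - (k0 : ℤ) - 2)) = 0 := by
    intro j hj
    have := hjl j
    rw [hidx, Fcoef_zero, Fcoef_zero, sub_zero]
    · linarith
    · rw [mul_assoc]; omega
  have hsum : ∑ j ∈ Finset.range (N + 1), (Fcoef N ((K : ℤ) + 2 * j * l) -
      Fcoef N (((k1 : ℤ) + 2 * (j : ℤ) + 2) * l - (k0 : ℤ) - 2)) =
      ∑ j ∈ Finset.range (s + 1), (Fcoef N ((K : ℤ) + 2 * j * l) -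
      Fcoef N (((k1 : ℤ) + 2 * (j : ℤ) + 2) * l - (k0 : ℤ) - 2)) := by
    symm
    apply Finset.sum_subset
    · intro x; simp only [Finset.mem_range]; omega
    · intro x _ hx
      apply hz
      simp only [Finset.mem_range] at hx; omega
  have hC : (N.choose s : ℤ) = ∑ j ∈ Finset.range (s + 1), (if j = 0 then (N.choose s : ℤ) else 0) := by
    simp
  rw [hsum, hC, ← Finset.sum_sub_distrib, Finset.sum_mul]
  refine (Finset.abs_sum_le_sum_abs _ _).trans ?_
  refine (Finset.sum_le_card_nsmul _ _ (2 * (N : ℤ) ^ s) ?_).trans ?_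
  · intro j _
    have hj := hjl j
    have h2 := Fcoef_bound N s hN (((k1 : ℤ) + 2 * (j : ℤ) + 2) * l - (k0 : ℤ) - 2)
      (by rw [hidx]; linarith)
    rw [abs_le] at h2
    split_ifs with h0
    · subst h0
      rw [abs_le] at hm ⊢
      simp only [Nat.cast_zero, mul_zero, zero_mul, add_zero] at h2 ⊢
      constructor <;> linarith
    · have h1 := Fcoef_bound N s hN ((K : ℤ) + 2 * j * l)
        (by rw [mul_assoc]; omega)
      rw [abs_le] at h1 ⊢
      constructor <;> linarith
  · simp only [Finset.card_range, nsmul_eq_mul]; push_cast; linarith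

lemma choose_lim (s : ℕ) :
    Tendsto (fun N : ℕ => (s.factorial : ℝ) * (N.choose s : ℝ) / (N : ℝ) ^ s) atTop (nhds 1) := by
  have h : ∀ t : ℕ, Tendsto (fun N : ℕ => (N.descFactorial t : ℝ) / (N : ℝ) ^ t)
      atTop (nhds 1) := by
    intro t
    induction t with
    | zero => simp
    | succ t ih =>
      have h1 : Tendsto (fun N : ℕ => 1 - (t : ℝ) / (N : ℝ)) atTop (nhds (1 - 0)) :=
        tendsto_const_nhds.sub (tendsto_const_div_atTop_nhds_zero_nat _)
      have h2 := h1.mul ih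
      rw [sub_zero, one_mul] at h2
      refine h2.congr' ?_
      filter_upwards [eventually_ge_atTop (t + 1)] with N hN
      have : (N : ℝ) ≠ 0 := by
        have : N ≠ 0 := by omega
        exact_mod_cast this
      rw [Nat.descFactorial_succ, Nat.cast_mul, Nat.cast_sub (by omega), pow_succ]
      field_simp
  refine (h s).congr fun N => ?_
  rw [Nat.descFactorial_eq_factorial_mul_choose, Nat.cast_mul]

theorem stmt13 (l s : ℕ) (hl : Odd l) (hl3 : 3 ≤ l) :
    Tendsto (fun N : ℕ => (s.factorial : ℝ) * (Mmult l (N - 2 * s) N : ℝ) / (N : ℝ) ^ s)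
      atTop (nhds 1) := by
  have hd : Tendsto (fun N : ℕ => (s.factorial : ℝ) *
      ((Mmult l (N - 2 * s) N : ℝ) - N.choose s) / (N : ℝ) ^ s) atTop (nhds 0) := by
    refine squeeze_zero_norm' (a := fun N : ℕ => (s.factorial * ((s + 1) * 2) : ℝ) / N) ?_
      (tendsto_const_div_atTop_nhds_zero_nat _)
    filter_upwards [eventually_ge_atTop (2 * s + 1)] with N hN
    have hb := Mmult_bound l s N hl3 (by omega) (by omega)
    have hb' : |((Mmult l (N - 2 * s) N : ℝ) - N.choose s) * N| ≤ (s + 1) * 2 * (N : ℝ) ^ s := by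
      exact_mod_cast hb
    have hNp : (0 : ℝ) < N := by
      have : 0 < N := by omega
      exact_mod_cast this
    rw [abs_mul, abs_of_pos hNp] at hb'
    rw [Real.norm_eq_abs, abs_div, abs_mul, abs_of_pos (pow_pos hNp s), Nat.abs_cast,
      div_le_div_iff₀ (pow_pos hNp s) hNp, mul_assoc, mul_assoc (s.factorial : ℝ)]
    exact mul_le_mul_of_nonneg_left hb' (Nat.cast_nonneg _)
  have := hd.add (choose_lim s)
  rw [zero_add] at this
  refine this.congr fun N => ?_
  ring
end
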